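/- For every d ∈ ℕ, the k-subspace {f ∈ k[X] : f ∈ Algebra.adjoin k {X^q − X} and natDegree f ≤ d} of k[X] has dimension ⌊d/q⌋ + 1 over k; indeed the powers (X^q − X)^i for 0 ≤ i ≤ ⌊d/q⌋ form a k-basis of this subspace. (This computes the cofinite type (1, q⁻¹) of the mock injective G_a-module J = ind_{G_a(F_q)}^{G_a}(k), as asserted in Example 6.8(3) of the paper.) -/

import Mathlib

open Polynomial

/-- The `k`-subspace `{f ∈ k[X] : f ∈ Algebra.adjoin k {X^q - X} ∧ natDegree f ≤ d}`. -/
noncomputable def adjDegLE (k : Type*) [Field k] (q d : ℕ) : Submodule k (Polynomial k) where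
  carrier := {f : Polynomial k |
    f ∈ Algebra.adjoin k {Polynomial.X ^ q - Polynomial.X} ∧ f.natDegree ≤ d}
  zero_mem' := ⟨Subalgebra.zero_mem _, by simp⟩
  add_mem' := by
    rintro f g ⟨hf, hfd⟩ ⟨hg, hgd⟩
    exact ⟨add_mem hf hg, le_trans (Polynomial.natDegree_add_le f g) (max_le hfd hgd)⟩
  smul_mem' := by
    rintro c f ⟨hf, hfd⟩
    exact ⟨Subalgebra.smul_mem _ hf c, le_trans (Polynomial.natDegree_smul_le c f) hfd⟩

/-- Over a field, substituting a nonconstant polynomial is injective. -/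
theorem aeval_injective_of_natDegree_pos {k : Type*} [Field k] {P : k[X]}
    (hP : 0 < P.natDegree) : Function.Injective (aeval P : k[X] →ₐ[k] k[X]) := by
  rw [injective_iff_map_eq_zero]
  intro g hg
  rw [← comp_eq_aeval, comp_eq_zero_iff] at hg
  rcases hg with hg | ⟨-, hg⟩
  · exact hg
  · rw [hg, natDegree_C] at hP
    exact absurd hP (lt_irrefl 0)

theorem adjDegLE_eq_map_degreeLT {k : Type*} [Field k] {q : ℕ} (hq : 1 < q) (d : ℕ) :
    adjDegLE k q d =
      (degreeLT k (d / q + 1)).map (aeval (X ^ q - X : k[X])).toLinearMap := by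
  have key (g : k[X]) :
      (aeval (X ^ q - X : k[X]) g).natDegree ≤ d ↔ g ∈ degreeLT k (d / q + 1) := by
    rw [← comp_eq_aeval, natDegree_comp, FiniteField.X_pow_card_sub_X_natDegree_eq k hq,
      ← Nat.le_div_iff_mul_le (by lia), mem_degreeLT, degree_lt_iff_coeff_zero,
      natDegree_le_iff_coeff_eq_zero]
    rfl
  ext f
  change f ∈ Algebra.adjoin k {X ^ q - X} ∧ f.natDegree ≤ d ↔ _
  rw [Algebra.adjoin_singleton_eq_range_aeval]
  constructor
  · rintro ⟨⟨g, rfl⟩, hg⟩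
    exact ⟨g, (key g).1 hg, rfl⟩
  · rintro ⟨g, hg, rfl⟩
    exact ⟨⟨g, rfl⟩, (key g).2 hg⟩

/-- Example 6.8(3): the subspace of polynomials in `X^q - X` of degree at most `d` has
dimension `⌊d/q⌋ + 1` over `k`; indeed the powers `(X^q - X)^i`, `0 ≤ i ≤ ⌊d/q⌋`, form a
`k`-basis.  This computes the cofinite type `(1, q⁻¹)` of the mock injective
`𝔾_a`-module `ind_{𝔾_a(𝔽_q)}^{𝔾_a}(k)`. -/
theorem stmt_19 {k : Type*} [Field k] (p r : ℕ) [Fact (Nat.Prime p)] [CharP k p]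
    (hr : 1 ≤ r) (q : ℕ) (hq : q = p ^ r) (d : ℕ) :
    Module.finrank k (adjDegLE k q d) = d / q + 1 ∧
    ∃ b : Module.Basis (Fin (d / q + 1)) k (adjDegLE k q d),
      ∀ i : Fin (d / q + 1),
        (b i : Polynomial k) = (Polynomial.X ^ q - Polynomial.X) ^ (i : ℕ) := by
  have hq1 : 1 < q := hq ▸ Nat.one_lt_pow (by lia) (Fact.out : p.Prime).one_lt
  have hinj : Function.Injective (aeval (X ^ q - X : k[X])).toLinearMap :=
    aeval_injective_of_natDegree_pos
      (by rw [FiniteField.X_pow_card_sub_X_natDegree_eq k hq1]; lia)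
  let b : Module.Basis (Fin (d / q + 1)) k (adjDegLE k q d) :=
    (degreeLT.basis k (d / q + 1)).map
      ((Submodule.equivMapOfInjective _ hinj _).trans
        (LinearEquiv.ofEq _ _ (adjDegLE_eq_map_degreeLT hq1 d).symm))
  refine ⟨by rw [Module.finrank_eq_card_basis b, Fintype.card_fin], b, fun i => ?_⟩
  simp [b]
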